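/- In the setting of the one-step construction—probability spaces (Ω_n, 𝒜_n, P_n), θ ∈ ℝ^k, maps Δ_n with asymptotic linearity Δ_n(θ + n^{−1/2}τ_n) − Δ_n(θ) + ϒτ_n → 0 in P_n-probability for every bounded deterministic sequence (τ_n), a uniformly tight and asymptotically discrete preliminary estimator θ̂_n with n^{1/2}(θ̂_n − θ) uniformly tight, consistent invertible estimators ϒ̂_n → ϒ in P_n-probability, and θ̃_n := θ̂_n + n^{−1/2} ϒ̂_n^{−1} Δ_n(θ̂_n)—assume in addition that the laws of Δ_n(θ) under P_n converge weakly to the pushforward of the standard Gaussian measure on ℝ^k under a linear map L : ℝ^k → ℝ^k. Then the laws of n^{1/2}(θ̃_n − θ) under P_n converge weakly to the pushforward of the standard Gaussian measure on ℝ^k under the linear map ϒ^{−1}L; i.e., n^{1/2}(θ̃_n − θ) is asymptotically centered Gaussian with covariance ϒ^{−1} L Lᵀ (ϒ^{−1})ᵀ. -/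

import Mathlib

open MeasureTheory
open scoped BigOperators ENNReal

attribute [local instance] Matrix.normedAddCommGroup

/-- Action of a `k×k` matrix on a vector of `ℝ^k` (Euclidean space). -/
noncomputable def matVec {k : ℕ} (A : Matrix (Fin k) (Fin k) ℝ)
    (v : EuclideanSpace ℝ (Fin k)) : EuclideanSpace ℝ (Fin k) :=
  (EuclideanSpace.equiv (Fin k) ℝ).symm (A.mulVec (EuclideanSpace.equiv (Fin k) ℝ v))

/-- The standard Gaussian measure on `ℝ^ι`: the product of standard normal distributions. -/
noncomputable def stdGaussian (ι : Type*) [Fintype ι] : Measure (EuclideanSpace ℝ ι) :=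
  Measure.map (⇑(EuclideanSpace.equiv ι ℝ).symm)
    (Measure.pi fun _ : ι => ProbabilityTheory.gaussianReal 0 1)

open Filter Topology

/-- Convergence to zero in (outer) probability along a sequence of spaces `(Ω n, P n)`. -/
def TendstoZeroInProb {Ω : ℕ → Type*} [∀ n, MeasurableSpace (Ω n)] (P : ∀ n, Measure (Ω n))
    {E : Type*} [NormedAddCommGroup E] (X : ∀ n, Ω n → E) : Prop :=
  ∀ ε > (0 : ℝ), Tendsto (fun n => P n {ω | ε < ‖X n ω‖}) atTop (𝓝 0)

/-- Asymptotic uniform tightness along a sequence of spaces `(Ω n, P n)`. -/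
def AsympTight {Ω : ℕ → Type*} [∀ n, MeasurableSpace (Ω n)] (P : ∀ n, Measure (Ω n))
    {E : Type*} [NormedAddCommGroup E] (X : ∀ n, Ω n → E) : Prop :=
  ∀ δ > (0 : ℝ≥0∞), ∃ M : ℝ, ∀ᶠ n in atTop, P n {ω | M < ‖X n ω‖} ≤ δ

section InProbability

variable {Ω : ℕ → Type*} [∀ n, MeasurableSpace (Ω n)] {P : ∀ n, Measure (Ω n)}
  {E F : Type*} [NormedAddCommGroup E] [NormedAddCommGroup F]

lemma AsympTight.of_forall_ofReal {X : ∀ n, Ω n → E}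
    (h : ∀ ε > (0 : ℝ), ∃ M : ℝ, ∀ n, P n {ω | M < ‖X n ω‖} ≤ ENNReal.ofReal ε) :
    AsympTight P X := by
  intro δ hδ
  obtain ⟨r, hr0, hrδ⟩ := ENNReal.lt_iff_exists_nnreal_btwn.1 hδ
  obtain ⟨M, hM⟩ := h r (by exact_mod_cast hr0)
  exact ⟨M, .of_forall fun n => (hM n).trans (by simpa using hrδ.le)⟩

lemma TendstoZeroInProb.asympTight {X : ∀ n, Ω n → E} (h : TendstoZeroInProb P X) :
    AsympTight P X :=
  fun δ hδ => ⟨1, ENNReal.tendsto_nhds_zero.1 (h 1 one_pos) δ hδ⟩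

lemma TendstoZeroInProb.add {X Y : ∀ n, Ω n → E} (hX : TendstoZeroInProb P X)
    (hY : TendstoZeroInProb P Y) : TendstoZeroInProb P (fun n ω => X n ω + Y n ω) := by
  intro ε hε
  have h := (hX (ε / 2) (half_pos hε)).add (hY (ε / 2) (half_pos hε))
  rw [add_zero] at h
  refine tendsto_of_tendsto_of_tendsto_of_le_of_le tendsto_const_nhds h (fun _ => zero_le)
    fun n => (measure_mono fun ω hω => ?_).trans (measure_union_le _ _)
  by_contra hcon
  simp only [Set.mem_union, Set.mem_ofPred_eq, not_or, not_lt] at hcon hω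
  linarith [norm_add_le (X n ω) (Y n ω)]

lemma AsympTight.add {X Y : ∀ n, Ω n → E} (hX : AsympTight P X) (hY : AsympTight P Y) :
    AsympTight P (fun n ω => X n ω + Y n ω) := by
  intro δ hδ
  obtain ⟨M, hM⟩ := hX (δ / 2) (ENNReal.half_pos hδ.ne')
  obtain ⟨N, hN⟩ := hY (δ / 2) (ENNReal.half_pos hδ.ne')
  refine ⟨M + N, ?_⟩
  filter_upwards [hM, hN] with n h₁ h₂
  calc P n {ω | M + N < ‖X n ω + Y n ω‖}
      ≤ P n ({ω | M < ‖X n ω‖} ∪ {ω | N < ‖Y n ω‖}) := measure_mono fun ω hω => by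
        by_contra hcon
        simp only [Set.mem_union, Set.mem_ofPred_eq, not_or, not_lt] at hcon hω
        linarith [norm_add_le (X n ω) (Y n ω)]
    _ ≤ δ / 2 + δ / 2 := (measure_union_le _ _).trans (add_le_add h₁ h₂)
    _ = δ := ENNReal.add_halves δ

lemma TendstoZeroInProb.of_eventually_eq {X Y : ∀ n, Ω n → E} (hX : TendstoZeroInProb P X)
    (h : ∀ᶠ n in atTop, Y n = X n) : TendstoZeroInProb P Y := by
  intro ε hε
  refine (hX ε hε).congr' ?_
  filter_upwards [h] with n hn
  rw [hn]

/-- A random field tending to zero in probability along bounded deterministic sequences does so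
along tight, asymptotically discrete random sequences. -/
lemma TendstoZeroInProb.comp_discrete {W : ∀ n, E → Ω n → F} {H : ∀ n, Ω n → E}
    (hW : ∀ τ : ℕ → E, (∃ M : ℝ, ∀ n, ‖τ n‖ ≤ M) → TendstoZeroInProb P (fun n => W n (τ n)))
    (hH : AsympTight P H)
    (hdisc : ∀ c > (0 : ℝ), ∃ K : ℕ, ∀ n : ℕ, ∃ s : Finset E, s.card ≤ K ∧
      ∀ ω : Ω n, ‖H n ω‖ ≤ c → H n ω ∈ s) :
    TendstoZeroInProb P (fun n ω => W n (H n ω) ω) := by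
  classical
  refine fun ε hε => ENNReal.tendsto_nhds_zero.2 fun δ hδ => ?_
  obtain ⟨M, hM⟩ := hH (δ / 2) (ENNReal.half_pos hδ.ne')
  have hc : 0 < |M| + 1 := by positivity
  obtain ⟨K, hK⟩ := hdisc (|M| + 1) hc
  set η : ℝ≥0∞ := δ / 2 / K with hη
  have hηpos : 0 < η := ENNReal.div_pos (ENNReal.half_pos hδ.ne').ne' (ENNReal.natCast_ne_top K)
  have hunif : ∀ᶠ n in atTop, ∀ t : E, ‖t‖ ≤ |M| + 1 → P n {ω | ε < ‖W n t ω‖} ≤ η := by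
    have hex : ∀ n, ∃ t : E, ‖t‖ ≤ |M| + 1 ∧ (P n {ω | ε < ‖W n t ω‖} ≤ η →
        ∀ t : E, ‖t‖ ≤ |M| + 1 → P n {ω | ε < ‖W n t ω‖} ≤ η) := by
      intro n
      by_cases h : ∀ t : E, ‖t‖ ≤ |M| + 1 → P n {ω | ε < ‖W n t ω‖} ≤ η
      · exact ⟨0, by simpa using hc.le, fun _ => h⟩
      · push Not at h
        obtain ⟨t, ht, hlt⟩ := h
        exact ⟨t, ht, fun hle => absurd hlt hle.not_gt⟩
    choose τ hτ hτ' using hex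
    exact (ENNReal.tendsto_nhds_zero.1 (hW τ ⟨_, hτ⟩ ε hε) η hηpos).mono hτ'
  filter_upwards [hM, hunif] with n h₁ h₂
  obtain ⟨s, hsK, hs⟩ := hK n
  set s' := s.filter fun t => ‖t‖ ≤ |M| + 1 with hs'
  calc P n {ω | ε < ‖W n (H n ω) ω‖}
      ≤ P n ({ω | M < ‖H n ω‖} ∪ ⋃ t ∈ s', {ω | ε < ‖W n t ω‖}) := measure_mono fun ω hω => by
        by_cases hω' : M < ‖H n ω‖
        · exact Or.inl hω'
        · have hle : ‖H n ω‖ ≤ |M| + 1 := by linarith [not_lt.1 hω', le_abs_self M]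
          exact Or.inr (Set.mem_biUnion (Finset.mem_filter.2 ⟨hs ω hle, hle⟩) hω)
    _ ≤ P n {ω | M < ‖H n ω‖} + P n (⋃ t ∈ s', {ω | ε < ‖W n t ω‖}) := measure_union_le _ _
    _ ≤ P n {ω | M < ‖H n ω‖} + ∑ t ∈ s', P n {ω | ε < ‖W n t ω‖} := by
        gcongr
        exact measure_biUnion_finset_le _ _
    _ ≤ δ / 2 + s'.card • η := by
        gcongr
        exact Finset.sum_le_card_nsmul _ _ _ fun t ht => h₂ t (Finset.mem_filter.1 ht).2
    _ ≤ δ / 2 + K * η := by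
        rw [nsmul_eq_mul]
        gcongr
        exact (Finset.card_filter_le _ _).trans hsK
    _ ≤ δ / 2 + δ / 2 := by
        gcongr
        exact ENNReal.mul_div_le
    _ = δ := ENNReal.add_halves δ

variable [NormedSpace ℝ E] [NormedSpace ℝ F]

lemma AsympTight.clm_apply {X : ∀ n, Ω n → E} (hX : AsympTight P X) (T : E →L[ℝ] F) :
    AsympTight P (fun n ω => T (X n ω)) := by
  intro δ hδ
  obtain ⟨M, hM⟩ := hX δ hδ
  refine ⟨‖T‖ * M, hM.mono fun n hn => (measure_mono fun ω hω => ?_).trans hn⟩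
  simp only [Set.mem_ofPred_eq] at hω ⊢
  exact lt_of_mul_lt_mul_left (hω.trans_le (T.le_opNorm _)) (norm_nonneg T)

/-- A random operator tending to zero in probability, applied to a tight sequence, gives a sequence
tending to zero in probability. -/
lemma TendstoZeroInProb.clm_apply {A : ∀ n, Ω n → E →L[ℝ] F} (hA : TendstoZeroInProb P A)
    {X : ∀ n, Ω n → E} (hX : AsympTight P X) :
    TendstoZeroInProb P (fun n ω => A n ω (X n ω)) := by
  refine fun ε hε => ENNReal.tendsto_nhds_zero.2 fun δ hδ => ?_
  obtain ⟨M, hM⟩ := hX (δ / 2) (ENNReal.half_pos hδ.ne')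
  have hM' : 0 < |M| + 1 := by positivity
  have hA' := ENNReal.tendsto_nhds_zero.1 (hA (ε / (|M| + 1)) (div_pos hε hM')) (δ / 2)
    (ENNReal.half_pos hδ.ne')
  filter_upwards [hM, hA'] with n h₁ h₂
  calc P n {ω | ε < ‖A n ω (X n ω)‖}
      ≤ P n ({ω | M < ‖X n ω‖} ∪ {ω | ε / (|M| + 1) < ‖A n ω‖}) := measure_mono fun ω hω => by
        by_contra hcon
        simp only [Set.mem_union, Set.mem_ofPred_eq, not_or, not_lt] at hcon hω
        have hXM : ‖X n ω‖ ≤ |M| + 1 := by linarith [hcon.1, le_abs_self M]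
        have h := (A n ω).le_of_opNorm_le_of_le hcon.2 hXM
        rw [div_mul_cancel₀ _ hM'.ne'] at h
        exact absurd hω h.not_gt
    _ ≤ δ / 2 + δ / 2 := (measure_union_le _ _).trans (add_le_add h₁ h₂)
    _ = δ := ENNReal.add_halves δ

lemma TendstoZeroInProb.const_clm_apply {X : ∀ n, Ω n → E} (hX : TendstoZeroInProb P X)
    (T : E →L[ℝ] F) : TendstoZeroInProb P (fun n ω => T (X n ω)) := by
  intro ε hε
  have hT : 0 < ‖T‖ + 1 := by positivity
  refine tendsto_of_tendsto_of_tendsto_of_le_of_le tendsto_const_nhds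
    (hX (ε / (‖T‖ + 1)) (div_pos hε hT)) (fun _ => zero_le)
    fun n => measure_mono fun ω hω => ?_
  simp only [Set.mem_ofPred_eq] at hω ⊢
  rw [div_lt_iff₀' hT]
  exact hω.trans_le (T.le_of_opNorm_le (by linarith) _)

end InProbability

/-- Slutsky's lemma along a sequence of probability spaces: a perturbation tending to zero in
probability does not change the weak limit of the laws. -/
lemma tendsto_integral_of_tendstoZeroInProb_sub {Ω : ℕ → Type*} [∀ n, MeasurableSpace (Ω n)]
    {P : ∀ n, Measure (Ω n)} [∀ n, IsProbabilityMeasure (P n)]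
    {E : Type*} [NormedAddCommGroup E] [MeasurableSpace E] [BorelSpace E]
    [SecondCountableTopology E]
    {ν : Measure E} [IsProbabilityMeasure ν] {X Y : ∀ n, Ω n → E}
    (hX : ∀ n, Measurable (X n)) (hY : ∀ n, Measurable (Y n))
    (hXν : ∀ f : BoundedContinuousFunction E ℝ,
      Tendsto (fun n => ∫ ω, f (X n ω) ∂(P n)) atTop (𝓝 (∫ x, f x ∂ν)))
    (hXY : TendstoZeroInProb P (fun n ω => Y n ω - X n ω))
    (f : BoundedContinuousFunction E ℝ) :
    Tendsto (fun n => ∫ ω, f (Y n ω) ∂(P n)) atTop (𝓝 (∫ x, f x ∂ν)) := by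
  let μ : ℕ → ProbabilityMeasure E :=
    fun n => ⟨(P n).map (Y n), Measure.isProbabilityMeasure_map (hY n).aemeasurable⟩
  have hμ : ∀ g : E → ℝ, Continuous g → ∀ n, ∫ x, g x ∂(μ n : Measure E) =
      ∫ ω, g (Y n ω) ∂(P n) := fun g hg n =>
    integral_map (hY n).aemeasurable hg.aestronglyMeasurable
  let μ₀ : ProbabilityMeasure E := ⟨ν, inferInstance⟩
  suffices h : Tendsto μ atTop (𝓝 μ₀) by
    have := ProbabilityMeasure.tendsto_iff_forall_integral_tendsto.1 h f
    simp only [hμ f f.continuous] at this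
    exact this
  refine tendsto_iff_forall_lipschitz_integral_tendsto.2 ?_
  rintro g ⟨C, hC⟩ ⟨K, hK⟩
  simp only [hμ g hK.continuous]
  let g' : BoundedContinuousFunction E ℝ := ⟨⟨g, hK.continuous⟩, C, hC⟩
  have hdiff : Tendsto (fun n => ∫ ω, g (Y n ω) ∂(P n) - ∫ ω, g (X n ω) ∂(P n)) atTop (𝓝 0) := by
    have hint : ∀ {Z : ∀ n, Ω n → E}, (∀ n, Measurable (Z n)) → ∀ n,
        Integrable (fun ω => g (Z n ω)) (P n) := fun hZ n =>
      Integrable.of_bound (hK.continuous.measurable.comp (hZ n)).aestronglyMeasurable ‖g'‖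
        (ae_of_all _ fun ω => g'.norm_coe_le_norm _)
    rw [Metric.tendsto_nhds]
    intro ε hε
    have hK1 : 0 < (K : ℝ) + 1 := by positivity
    set r : ℝ := ε / 2 / (K + 1) with hr
    have hr0 : 0 < r := div_pos (half_pos hε) hK1
    have hKr : K * r < ε := by
      have : (K + 1) * r = ε / 2 := mul_div_cancel₀ _ hK1.ne'
      nlinarith
    have hlim : Tendsto (fun n => K * r + C * (P n).real {ω | r < ‖Y n ω - X n ω‖}) atTop
        (𝓝 (K * r + C * 0)) :=
      ((ENNReal.tendsto_toReal ENNReal.zero_ne_top).comp (hXY r hr0)).const_mul C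
        |>.const_add _
    rw [mul_zero, add_zero] at hlim
    filter_upwards [hlim.eventually_lt_const hKr] with n hn
    have hS : MeasurableSet {ω | r < ‖Y n ω - X n ω‖} :=
      measurableSet_lt measurable_const ((hY n).sub (hX n)).norm
    rw [dist_zero_right, ← integral_sub (hint hY n) (hint hX n)]
    refine lt_of_le_of_lt ?_ hn
    have hbound : ∀ ω, ‖g (Y n ω) - g (X n ω)‖ ≤
        K * r + {ω | r < ‖Y n ω - X n ω‖}.indicator (fun _ => C) ω := by
      intro ω
      by_cases hω : r < ‖Y n ω - X n ω‖
      · rw [Set.indicator_of_mem (show ω ∈ {ω | r < ‖Y n ω - X n ω‖} from hω), ← dist_eq_norm]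
        have := hC (Y n ω) (X n ω)
        have : 0 ≤ K * r := by positivity
        linarith
      · rw [Set.indicator_of_notMem (show ω ∉ {ω | r < ‖Y n ω - X n ω‖} from hω), add_zero]
        exact hK.norm_sub_le_of_le (not_lt.1 hω)
    have hi : Integrable ({ω | r < ‖Y n ω - X n ω‖}.indicator fun _ => C) (P n) :=
      (integrable_const C).indicator hS
    calc ‖∫ ω, g (Y n ω) - g (X n ω) ∂(P n)‖
        ≤ ∫ ω, (K * r + {ω | r < ‖Y n ω - X n ω‖}.indicator (fun _ => C) ω) ∂(P n) :=
          norm_integral_le_of_norm_le ((integrable_const _).add hi) (ae_of_all _ hbound)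
      _ = K * r + C * (P n).real {ω | r < ‖Y n ω - X n ω‖} := by
          rw [integral_add (integrable_const _) hi, integral_indicator_const _ hS]
          simp [mul_comm]
  have hsum := hdiff.add (hXν g')
  rw [zero_add] at hsum
  exact hsum.congr fun n => sub_add_cancel _ _

lemma matVec_eq_toEuclideanCLM {k : ℕ} (A : Matrix (Fin k) (Fin k) ℝ)
    (v : EuclideanSpace ℝ (Fin k)) : matVec A v = Matrix.toEuclideanCLM (𝕜 := ℝ) A v := rfl

instance isProbabilityMeasure_stdGaussian (ι : Type*) [Fintype ι] :
    IsProbabilityMeasure (stdGaussian ι) :=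
  Measure.isProbabilityMeasure_map
    (EuclideanSpace.equiv ι ℝ).symm.continuous.measurable.aemeasurable

/-- Consistency of invertible matrix estimators is inherited by the operators of the inverses. -/
lemma TendstoZeroInProb.toEuclideanCLM_inv_sub {k : ℕ} {Ω : ℕ → Type*}
    [∀ n, MeasurableSpace (Ω n)] {P : ∀ n, Measure (Ω n)} {A : Matrix (Fin k) (Fin k) ℝ}
    (hA : IsUnit A) {B : ∀ n, Ω n → Matrix (Fin k) (Fin k) ℝ}
    (hB : TendstoZeroInProb P (fun n ω => B n ω - A)) :
    TendstoZeroInProb P (fun n ω => Matrix.toEuclideanCLM (𝕜 := ℝ) (B n ω)⁻¹ -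
      Matrix.toEuclideanCLM (𝕜 := ℝ) A⁻¹) := by
  intro ε hε
  have hcont : ContinuousAt
      (fun M : Matrix (Fin k) (Fin k) ℝ => Matrix.toEuclideanCLM (𝕜 := ℝ) M⁻¹) A := by
    have hT : Continuous (Matrix.toEuclideanCLM (n := Fin k) (𝕜 := ℝ)) :=
      (Matrix.toEuclideanCLM (n := Fin k) (𝕜 := ℝ)).toAlgEquiv.toLinearMap.continuous_of_finiteDimensional
    refine hT.continuousAt.comp (continuousAt_matrix_inv A ?_)
    obtain ⟨u, hu⟩ := (Matrix.isUnit_iff_isUnit_det A).1 hA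
    rw [← hu]
    exact NormedRing.inverse_continuousAt u
  obtain ⟨δ, hδ, h⟩ := Metric.continuousAt_iff.1 hcont ε hε
  refine tendsto_of_tendsto_of_tendsto_of_le_of_le tendsto_const_nhds
    (hB (δ / 2) (half_pos hδ)) (fun _ => zero_le) fun n => measure_mono fun ω hω => ?_
  by_contra hcon
  simp only [Set.mem_ofPred_eq, not_lt] at hcon hω
  have := h (x := B n ω) (by rw [dist_eq_norm]; linarith)
  rw [dist_eq_norm] at this
  exact absurd hω this.not_gt

/-- **Asymptotic normality of the one-step estimator.**  In the one-step setting (asymptotic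
linearity with invertible slope `ϒ`, tight central sequence, root-`n` consistent and
asymptotically discrete preliminary estimator, consistent invertible `ϒ̂_n`), if moreover
the laws of `Δ_n(θ)` converge weakly to the pushforward of the standard Gaussian on `ℝ^k`
under a linear map `L`, then the laws of `n^{1/2}(θ̃_n − θ)` converge weakly to the
pushforward of the standard Gaussian under `ϒ⁻¹L`, i.e. `n^{1/2}(θ̃_n − θ)` is
asymptotically centered Gaussian with covariance `ϒ⁻¹ L Lᵀ (ϒ⁻¹)ᵀ`. -/
theorem one_step_asymptotic_normality
    {k : ℕ}
    (Ω : ℕ → Type*) [∀ n, MeasurableSpace (Ω n)]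
    (P : ∀ n, Measure (Ω n)) [∀ n, IsProbabilityMeasure (P n)]
    (θ : EuclideanSpace ℝ (Fin k))
    (Δ : ∀ n : ℕ, EuclideanSpace ℝ (Fin k) → Ω n → EuclideanSpace ℝ (Fin k))
    (hΔmeas : ∀ n ϑ, Measurable (Δ n ϑ))
    (Υ : Matrix (Fin k) (Fin k) ℝ) (hΥ : IsUnit Υ)
    (hlin : ∀ τ : ℕ → EuclideanSpace ℝ (Fin k), (∃ M : ℝ, ∀ n, ‖τ n‖ ≤ M) →
      ∀ ε > (0:ℝ),
        Filter.Tendsto (fun n => P n {ω |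
          ε < ‖Δ n (θ + (Real.sqrt n)⁻¹ • τ n) ω - Δ n θ ω + matVec Υ (τ n)‖})
          Filter.atTop (nhds 0))
    (htight : ∀ ε > (0:ℝ), ∃ M : ℝ, ∀ n,
      P n {ω | M < ‖Δ n θ ω‖} ≤ ENNReal.ofReal ε)
    (θhat : ∀ n : ℕ, Ω n → EuclideanSpace ℝ (Fin k))
    (hθhatmeas : ∀ n, Measurable (θhat n))
    (hθhattight : ∀ ε > (0:ℝ), ∃ M : ℝ, ∀ n,
      P n {ω | M < ‖(Real.sqrt n : ℝ) • (θhat n ω - θ)‖} ≤ ENNReal.ofReal ε)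
    (hdiscrete : ∀ c > (0:ℝ), ∃ K : ℕ, ∀ n : ℕ,
      ∃ s : Finset (EuclideanSpace ℝ (Fin k)), s.card ≤ K ∧
        ∀ ω : Ω n, ‖(Real.sqrt n : ℝ) • (θhat n ω - θ)‖ ≤ c →
          (Real.sqrt n : ℝ) • (θhat n ω - θ) ∈ s)
    (Υhat : ∀ n : ℕ, Ω n → Matrix (Fin k) (Fin k) ℝ)
    (hΥhatunit : ∀ n ω, IsUnit (Υhat n ω))
    (hΥhatcons : ∀ ε > (0:ℝ),
      Filter.Tendsto (fun n => P n {ω | ε < ‖Υhat n ω - Υ‖}) Filter.atTop (nhds 0))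
    (θtilde : ∀ n : ℕ, Ω n → EuclideanSpace ℝ (Fin k))
    (hθtildemeas : ∀ n, Measurable (θtilde n))
    (hθtilde : ∀ n ω, θtilde n ω =
      θhat n ω + (Real.sqrt n)⁻¹ • matVec (Υhat n ω)⁻¹ (Δ n (θhat n ω) ω))
    (L : Matrix (Fin k) (Fin k) ℝ)
    (hΔGauss : ∀ f : BoundedContinuousFunction (EuclideanSpace ℝ (Fin k)) ℝ,
      Filter.Tendsto (fun n => ∫ ω, f (Δ n θ ω) ∂(P n)) Filter.atTop
        (nhds (∫ x, f x ∂(Measure.map (fun x => matVec L x) (stdGaussian (Fin k)))))) :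
    ∀ f : BoundedContinuousFunction (EuclideanSpace ℝ (Fin k)) ℝ,
      Filter.Tendsto
        (fun n => ∫ ω, f ((Real.sqrt n : ℝ) • (θtilde n ω - θ)) ∂(P n)) Filter.atTop
        (nhds (∫ x, f x ∂(Measure.map (fun x => matVec Υ⁻¹ (matVec L x))
          (stdGaussian (Fin k))))) := by
  have hTinv : ∀ v, Matrix.toEuclideanCLM (𝕜 := ℝ) Υ⁻¹ (Matrix.toEuclideanCLM (𝕜 := ℝ) Υ v) = v := by
    intro v
    rw [← mul_apply_eq_comp, ← map_mul,
      Matrix.nonsing_inv_mul _ ((Matrix.isUnit_iff_isUnit_det Υ).1 hΥ), map_one,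
      one_apply_eq_self]
  simp only [matVec_eq_toEuclideanCLM] at *
  have hTinv' : ∀ n ω v, Matrix.toEuclideanCLM (𝕜 := ℝ) (Υhat n ω)⁻¹ v =
      (Matrix.toEuclideanCLM (𝕜 := ℝ) (Υhat n ω)⁻¹ - Matrix.toEuclideanCLM (𝕜 := ℝ) Υ⁻¹) v +
        Matrix.toEuclideanCLM (𝕜 := ℝ) Υ⁻¹ v := fun n ω v => by simp
  set T := Matrix.toEuclideanCLM (𝕜 := ℝ) Υ
  set S := Matrix.toEuclideanCLM (𝕜 := ℝ) Υ⁻¹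
  set G := Matrix.toEuclideanCLM (𝕜 := ℝ) L
  let H : ∀ n, Ω n → EuclideanSpace ℝ (Fin k) := fun n ω => Real.sqrt n • (θhat n ω - θ)
  let R : ∀ n, Ω n → EuclideanSpace ℝ (Fin k) := fun n ω =>
    Δ n (θ + (Real.sqrt n)⁻¹ • H n ω) ω - Δ n θ ω + T (H n ω)
  have hH : AsympTight P H := .of_forall_ofReal hθhattight
  have hR : TendstoZeroInProb P R := TendstoZeroInProb.comp_discrete
    (W := fun n t ω => Δ n (θ + (Real.sqrt n)⁻¹ • t) ω - Δ n θ ω + T t) hlin hH hdiscrete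
  have hV : AsympTight P (fun n ω => Δ n θ ω + R n ω + (-T) (H n ω)) :=
    ((AsympTight.of_forall_ofReal htight).add hR.asympTight).add (hH.clm_apply (-T))
  have hD := ((TendstoZeroInProb.toEuclideanCLM_inv_sub hΥ hΥhatcons).clm_apply hV).add
    (hR.const_clm_apply S)
  have hSG : AEMeasurable (fun x => S (G x)) (stdGaussian (Fin k)) :=
    (S.comp G).continuous.measurable.aemeasurable
  have : IsProbabilityMeasure ((stdGaussian (Fin k)).map fun x => S (G x)) :=
    Measure.isProbabilityMeasure_map hSG
  refine tendsto_integral_of_tendstoZeroInProb_sub (X := fun n ω => S (Δ n θ ω))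
    (fun n => S.continuous.measurable.comp (hΔmeas n θ))
    (fun n => ((hθtildemeas n).sub_const θ).const_smul (Real.sqrt n)) (fun f => ?_)
    (hD.of_eventually_eq ?_)
  · have h := hΔGauss (f.compContinuous ⟨S, S.continuous⟩)
    rw [integral_map G.continuous.measurable.aemeasurable
      (BoundedContinuousFunction.continuous _).aestronglyMeasurable] at h
    rw [integral_map hSG f.continuous.aestronglyMeasurable]
    exact h
  · filter_upwards [eventually_gt_atTop 0] with n hn
    have hn' : Real.sqrt n ≠ 0 := by positivity
    funext ω
    have hθH : θ + (Real.sqrt n)⁻¹ • H n ω = θhat n ω := by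
      simp only [H]
      rw [inv_smul_smul₀ hn', add_sub_cancel]
    have hΔR : Δ n θ ω + R n ω + (-T) (H n ω) = Δ n (θhat n ω) ω := by
      simp only [R, hθH, neg_apply]
      abel
    have hSR : S (R n ω) = S (Δ n (θhat n ω) ω) - S (Δ n θ ω) + H n ω := by
      simp only [R, hθH, map_add, map_sub, hTinv]
    rw [hΔR, hSR, hθtilde, add_sub_right_comm, smul_add, smul_inv_smul₀ hn', hTinv']
    simp only [H]
    abel
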